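/- Let P be a symmetric, invertible, C¹ matrix field on ω with div P = 0 (∂P_{ij}/∂x_i = 0 for each j), and let χ : Ω → ω be a C² diffeomorphism with F = ∇_X χ, J = det F, V² = F Fᵀ. Then for every C² function p, Δ_X (p∘χ) = J · P : ∇( J⁻¹ P⁻¹ V² ∇p ), i.e. Δ_X(p∘χ) = J P_{ij} ∂/∂x_j ( J⁻¹ (P⁻¹V²)_{ik} ∂p/∂x_k ). Conversely, if this identity holds for all C² functions p, then div P = 0. -/

import Mathlib

open Matrix

/-- Jacobi formula for the derivative of the determinant. -/
lemma hasFDerivAt_det_aux {d : ℕ} {A : (Fin d → ℝ) → Matrix (Fin d) (Fin d) ℝ} {x : Fin d → ℝ}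
    (hA : ∀ i j, DifferentiableAt ℝ (fun y => A y i j) x) :
    DifferentiableAt ℝ (fun y => (A y).det) x ∧
    ∀ v, fderiv ℝ (fun y => (A y).det) x v =
      ∑ i, ∑ j, (A x).adjugate j i * fderiv ℝ (fun y => A y i j) x v := by
  let D : ContinuousMultilinearMap ℝ (fun _ : Fin d => (Fin d → ℝ)) ℝ :=
    { (detRowAlternating : (Fin d → ℝ) [⋀^Fin d]→ₗ[ℝ] ℝ).toMultilinearMap with
      cont := by
        change Continuous (fun M : Matrix (Fin d) (Fin d) ℝ => M.det)
        exact continuous_id.matrix_det }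
  have hrow : HasFDerivAt (fun y => (fun i j => A y i j : Fin d → Fin d → ℝ))
      (ContinuousLinearMap.pi fun i => ContinuousLinearMap.pi fun j =>
        fderiv ℝ (fun y => A y i j) x) x := by
    rw [hasFDerivAt_pi]
    intro i
    rw [hasFDerivAt_pi]
    intro j
    exact (hA i j).hasFDerivAt
  have h := (D.hasFDerivAt (fun i j => A x i j)).comp x hrow
  have h' : HasFDerivAt (fun y => (A y).det) _ x := h
  refine ⟨h'.differentiableAt, fun v => ?_⟩
  rw [h'.fderiv, ContinuousLinearMap.comp_apply, ContinuousMultilinearMap.linearDeriv_apply]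
  refine Finset.sum_congr rfl fun i _ => ?_
  change ((A x).updateRow i (fun j => fderiv ℝ (fun y => A y i j) x v)).det = _
  rw [← cramer_transpose_apply, cramer_eq_adjugate_mulVec, ← adjugate_transpose]
  rfl

lemma differentiableAt_inv_entry_aux {d : ℕ} {A : (Fin d → ℝ) → Matrix (Fin d) (Fin d) ℝ}
    {x : Fin d → ℝ} (hA : ∀ i j, DifferentiableAt ℝ (fun y => A y i j) x)
    (hu : IsUnit (A x)) (i j : Fin d) :
    DifferentiableAt ℝ (fun y => (A y)⁻¹ i j) x := by
  have hdet : (A x).det ≠ 0 := ((Matrix.isUnit_iff_isUnit_det _).1 hu).ne_zero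
  have h1 : (fun y => (A y)⁻¹ i j) =
      fun y => ((A y).det)⁻¹ * ((A y).updateRow j (Pi.single i 1)).det := by
    funext y
    rw [Matrix.inv_def, Matrix.smul_apply, adjugate_apply, Ring.inverse_eq_inv', smul_eq_mul]
  rw [h1]
  refine ((hasFDerivAt_det_aux hA).1.inv hdet).mul (hasFDerivAt_det_aux ?_).1
  intro k l
  by_cases hk : k = j
  · subst hk
    simp
  · simp only [updateRow_ne hk]
    exact hA k l

section
variable {d : ℕ} {Ω ω : Set (Fin d → ℝ)} {χ ψ : (Fin d → ℝ) → (Fin d → ℝ)}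

/-- Chain rule `Fᵀ ∇ = ∇_X`. -/
lemma chain_aux (hΩ : IsOpen Ω) (hω : IsOpen ω)
    (hχ : ContDiffOn ℝ 2 χ Ω) (hψ : ContDiffOn ℝ 2 ψ ω)
    (hmaps' : Set.MapsTo ψ ω Ω)
    (hinv : ∀ x ∈ ω, χ (ψ x) = x) (hinv' : ∀ X ∈ Ω, ψ (χ X) = X)
    {x : Fin d → ℝ} (hx : x ∈ ω) {q : (Fin d → ℝ) → ℝ} (hq : DifferentiableAt ℝ q (ψ x))
    (I : Fin d) :
    ∑ j, fderiv ℝ χ (ψ x) (Pi.single I 1) j *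
      fderiv ℝ (fun y => q (ψ y)) x (Pi.single j 1) = fderiv ℝ q (ψ x) (Pi.single I 1) := by
  have hX := hmaps' hx
  have hdψ : DifferentiableAt ℝ ψ x :=
    (hψ.contDiffAt (hω.mem_nhds hx)).differentiableAt (by norm_num)
  have hdχ : DifferentiableAt ℝ χ (ψ x) :=
    (hχ.contDiffAt (hΩ.mem_nhds hX)).differentiableAt (by norm_num)
  have h1 : fderiv ℝ (fun y => q (ψ y)) x = (fderiv ℝ q (ψ x)).comp (fderiv ℝ ψ x) :=
    fderiv_comp x hq hdψ
  have hid : fderiv ℝ (ψ ∘ χ) (ψ x) = ContinuousLinearMap.id ℝ _ := by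
    have : (ψ ∘ χ) =ᶠ[nhds (ψ x)] id := by
      filter_upwards [hΩ.mem_nhds hX] with Y hY using hinv' Y hY
    rw [this.fderiv_eq, fderiv_id]
  have h2 : (fderiv ℝ ψ x).comp (fderiv ℝ χ (ψ x)) = ContinuousLinearMap.id ℝ _ := by
    rw [← hid, fderiv_comp (ψ x) (by rw [hinv x hx]; exact hdψ) hdχ, hinv x hx]
  have h3 : ∀ v : Fin d → ℝ, ∑ j, v j * fderiv ℝ (fun y => q (ψ y)) x (Pi.single j 1)
      = fderiv ℝ (fun y => q (ψ y)) x v := by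
    intro v
    conv_rhs => rw [pi_eq_sum_univ' v]
    simp [map_sum]
  rw [h3, h1]
  have := DFunLike.congr_fun h2 (Pi.single I 1)
  simp only [ContinuousLinearMap.comp_apply, ContinuousLinearMap.id_apply] at this ⊢
  rw [this]

/-- Differentiability of second-level objects. -/
lemma diff_fderiv_aux {E G : Type*} [NormedAddCommGroup E] [NormedSpace ℝ E]
    [NormedAddCommGroup G] [NormedSpace ℝ G] {f : E → G} {x : E} (hf : ContDiffAt ℝ 2 f x) :
    DifferentiableAt ℝ (fderiv ℝ f) x :=
  (hf.fderiv_right (m := 1) (by norm_num)).differentiableAt (by norm_num)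

lemma piola_aux (hΩ : IsOpen Ω) (hω : IsOpen ω)
    (hχ : ContDiffOn ℝ 2 χ Ω) (hψ : ContDiffOn ℝ 2 ψ ω)
    (hmaps' : Set.MapsTo ψ ω Ω)
    (hinv : ∀ x ∈ ω, χ (ψ x) = x) (hinv' : ∀ X ∈ Ω, ψ (χ X) = X)
    {F : (Fin d → ℝ) → Matrix (Fin d) (Fin d) ℝ}
    (hF : ∀ x, F x = Matrix.of fun i I => fderiv ℝ χ (ψ x) (Pi.single I 1) i)
    {J : (Fin d → ℝ) → ℝ} (hJ : ∀ x, J x = (F x).det)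
    {x : Fin d → ℝ} (hx : x ∈ ω) (hpos : 0 < J x) :
    (∀ i I, DifferentiableAt ℝ (fun y => F y i I) x) ∧ DifferentiableAt ℝ J x ∧
    ∀ I, ∑ j, fderiv ℝ (fun y => (J y)⁻¹ * F y j I) x (Pi.single j 1) = 0 := by
  have hX := hmaps' hx
  have hcψ := hψ.contDiffAt (hω.mem_nhds hx)
  have hcχ := hχ.contDiffAt (hΩ.mem_nhds hX)
  have hdψ : DifferentiableAt ℝ ψ x := hcψ.differentiableAt (by norm_num)
  have hd2 := diff_fderiv_aux hcχ
  let q : Fin d → Fin d → (Fin d → ℝ) → ℝ := fun l K Y => fderiv ℝ χ Y (Pi.single K 1) l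
  have hFq : ∀ l K, (fun y => F y l K) = fun y => q l K (ψ y) := by
    intro l K; funext y; rw [hF]; rfl
  have hqd : ∀ l K v, HasFDerivAt (q l K)
      ((ContinuousLinearMap.proj l).comp ((fderiv ℝ (fderiv ℝ χ) (ψ x)).flip v)) (ψ x) ∨ v ≠ Pi.single K 1 := by
    intro l K v
    by_cases hv : v = Pi.single K 1
    · left
      subst hv
      have h1 : HasFDerivAt (fun Y => fderiv ℝ χ Y (Pi.single K 1))
          ((fderiv ℝ (fderiv ℝ χ) (ψ x)).flip (Pi.single K 1)) (ψ x) := by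
        simpa using hd2.hasFDerivAt.clm_apply (hasFDerivAt_const (Pi.single K 1) (ψ x))
      exact (hasFDerivAt_pi'.1 h1) l
    · exact Or.inr hv
  have hqd' : ∀ l K, HasFDerivAt (q l K) ((ContinuousLinearMap.proj l).comp
      ((fderiv ℝ (fderiv ℝ χ) (ψ x)).flip (Pi.single K 1))) (ψ x) := fun l K =>
    (hqd l K _).resolve_right (fun h => h rfl)
  have hsymm : ∀ l K M, fderiv ℝ (q l K) (ψ x) (Pi.single M 1)
      = fderiv ℝ (q l M) (ψ x) (Pi.single K 1) := by
    intro l K M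
    rw [(hqd' l K).fderiv, (hqd' l M).fderiv]
    have := hcχ.isSymmSndFDerivAt (by simp) (Pi.single K 1) (Pi.single M 1)
    simp [this]
  have hFd : ∀ i I, DifferentiableAt ℝ (fun y => F y i I) x := by
    intro i I
    rw [hFq]
    exact (hqd' i I).differentiableAt.comp x hdψ
  have hchain : ∀ l K I, ∑ j, F x j I * fderiv ℝ (fun y => F y l K) x (Pi.single j 1)
      = fderiv ℝ (q l K) (ψ x) (Pi.single I 1) := by
    intro l K I
    rw [hFq]
    simp only [hF x, Matrix.of_apply]
    exact chain_aux hΩ hω hχ hψ hmaps' hinv hinv' hx (hqd' l K).differentiableAt I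
  have hJe : J = fun y => (F y).det := funext hJ
  obtain ⟨hJd, hJf⟩ := hasFDerivAt_det_aux hFd
  rw [← hJe] at hJd hJf
  refine ⟨hFd, hJd, fun I => ?_⟩
  have hJ0 : J x ≠ 0 := hpos.ne'
  have hprod : ∀ j, fderiv ℝ (fun y => (J y)⁻¹ * F y j I) x (Pi.single j 1) =
      (J x)⁻¹ ^ 2 * (J x * fderiv ℝ (fun y => F y j I) x (Pi.single j 1)
        - F x j I * fderiv ℝ J x (Pi.single j 1)) := by
    intro j
    have h := ((hasDerivAt_inv hJ0).comp_hasFDerivAt x hJd.hasFDerivAt).mul (hFd j I).hasFDerivAt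
    have h' : HasFDerivAt (fun y => (J y)⁻¹ * F y j I) _ x := h
    rw [h'.fderiv]
    simp
    field_simp
    ring
  have hA : ∑ j, F x j I * fderiv ℝ J x (Pi.single j 1) =
      ∑ l, ∑ K, (F x).adjugate K l * fderiv ℝ (q l K) (ψ x) (Pi.single I 1) := by
    simp only [← hchain, hJf, Finset.mul_sum]
    rw [Finset.sum_comm]
    refine Finset.sum_congr rfl fun l _ => ?_
    rw [Finset.sum_comm]
    refine Finset.sum_congr rfl fun K _ => Finset.sum_congr rfl fun j _ => by ring
  have hB : ∑ j, J x * fderiv ℝ (fun y => F y j I) x (Pi.single j 1) =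
      ∑ l, ∑ K, (F x).adjugate K l * fderiv ℝ (q l I) (ψ x) (Pi.single K 1) := by
    refine Finset.sum_congr rfl fun j _ => ?_
    simp only [← hchain, Finset.mul_sum]
    rw [Finset.sum_comm]
    have : ∀ l, ∑ K, F x l K * (F x).adjugate K j = if l = j then J x else 0 := by
      intro l
      have := congrFun (congrFun (Matrix.mul_adjugate (F x)) l) j
      rw [Matrix.mul_apply] at this
      rw [this, hJ]
      simp [Matrix.one_apply]
    have h2 : ∀ l, ∑ K, (F x).adjugate K j *
        (F x l K * fderiv ℝ (fun y => F y j I) x (Pi.single l 1)) =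
        (if l = j then J x else 0) * fderiv ℝ (fun y => F y j I) x (Pi.single l 1) := by
      intro l
      rw [← this, Finset.sum_mul]
      exact Finset.sum_congr rfl fun K _ => by ring
    simp [h2]
  simp only [hprod]
  rw [← Finset.mul_sum, Finset.sum_sub_distrib, hA, hB]
  simp only [hsymm _ I, sub_self, mul_zero]

/-- Classical transformation of the Laplacian. -/
lemma laplace_aux (hΩ : IsOpen Ω) (hω : IsOpen ω)
    (hχ : ContDiffOn ℝ 2 χ Ω) (hψ : ContDiffOn ℝ 2 ψ ω)
    (hmaps' : Set.MapsTo ψ ω Ω)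
    (hinv : ∀ x ∈ ω, χ (ψ x) = x) (hinv' : ∀ X ∈ Ω, ψ (χ X) = X)
    {F : (Fin d → ℝ) → Matrix (Fin d) (Fin d) ℝ}
    (hF : ∀ x, F x = Matrix.of fun i I => fderiv ℝ χ (ψ x) (Pi.single I 1) i)
    {J : (Fin d → ℝ) → ℝ} (hJ : ∀ x, J x = (F x).det)
    {x : Fin d → ℝ} (hx : x ∈ ω) (hpos : 0 < J x)
    {p : (Fin d → ℝ) → ℝ} (hp : ContDiff ℝ 2 p) :
    J x * ∑ j, fderiv ℝ (fun y => (J y)⁻¹ * ∑ k, (F y * (F y)ᵀ) j k *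
        fderiv ℝ p y (Pi.single k 1)) x (Pi.single j 1) =
    ∑ I, fderiv ℝ (fun Y => fderiv ℝ (p ∘ χ) Y (Pi.single I 1)) (ψ x) (Pi.single I 1) := by
  obtain ⟨hFd, hJd, hpio⟩ := piola_aux hΩ hω hχ hψ hmaps' hinv hinv' hF hJ hx hpos
  have hX := hmaps' hx
  have hcψ := hψ.contDiffAt (hω.mem_nhds hx)
  have hcχ := hχ.contDiffAt (hΩ.mem_nhds hX)
  have hdψ : DifferentiableAt ℝ ψ x := hcψ.differentiableAt (by norm_num)
  let u : Fin d → (Fin d → ℝ) → ℝ := fun I Y => fderiv ℝ (p ∘ χ) Y (Pi.single I 1)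
  have hud : ∀ I, DifferentiableAt ℝ (u I) (ψ x) := fun I =>
    (diff_fderiv_aux (hp.contDiffAt.comp (ψ x) hcχ)).clm_apply (differentiableAt_const _)
  have huψ : ∀ I, DifferentiableAt ℝ (fun y => u I (ψ y)) x := fun I =>
    (hud I).comp x hdψ
  have hJ0 : J x ≠ 0 := hpos.ne'
  have huval : ∀ y ∈ ω, ∀ I, u I (ψ y) = ∑ k, F y k I * fderiv ℝ p y (Pi.single k 1) := by
    intro y hy I
    have hdχ : DifferentiableAt ℝ χ (ψ y) :=
      (hχ.contDiffAt (hΩ.mem_nhds (hmaps' hy))).differentiableAt (by norm_num)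
    change fderiv ℝ (p ∘ χ) (ψ y) (Pi.single I 1) = _
    rw [fderiv_comp (ψ y) (hp.contDiffAt.differentiableAt (by norm_num)) hdχ, hinv y hy,
      ContinuousLinearMap.comp_apply]
    rw [pi_eq_sum_univ' (fderiv ℝ χ (ψ y) (Pi.single I 1))]
    simp [map_sum, hF]
  have hg : ∀ j, (fun y => (J y)⁻¹ * ∑ k, (F y * (F y)ᵀ) j k * fderiv ℝ p y (Pi.single k 1))
      =ᶠ[nhds x] fun y => ∑ I, ((J y)⁻¹ * F y j I) * u I (ψ y) := by
    intro j
    filter_upwards [hω.mem_nhds hx] with y hy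
    simp only [huval y hy, Matrix.mul_apply, Matrix.transpose_apply, Finset.mul_sum,
      Finset.sum_mul]
    rw [Finset.sum_comm]
    exact Finset.sum_congr rfl fun I _ => Finset.sum_congr rfl fun k _ => by ring
  have hcd : ∀ j I, DifferentiableAt ℝ (fun y => (J y)⁻¹ * F y j I) x := fun j I =>
    (hJd.inv hJ0).mul (hFd j I)
  have hder : ∀ j, fderiv ℝ (fun y => (J y)⁻¹ * ∑ k, (F y * (F y)ᵀ) j k *
        fderiv ℝ p y (Pi.single k 1)) x (Pi.single j 1) =
      ∑ I, (fderiv ℝ (fun y => (J y)⁻¹ * F y j I) x (Pi.single j 1) * u I (ψ x) +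
        (J x)⁻¹ * (F x j I * fderiv ℝ (fun y => u I (ψ y)) x (Pi.single j 1))) := by
    intro j
    rw [(hg j).fderiv_eq, fderiv_fun_sum (fun I _ => (hcd j I).fun_mul (huψ I)),
      _root_.sum_apply]
    refine Finset.sum_congr rfl fun I _ => ?_
    rw [fderiv_fun_mul (hcd j I) (huψ I)]
    simp
    ring
  simp only [hder]
  rw [Finset.sum_comm]
  rw [Finset.mul_sum]
  refine Finset.sum_congr rfl fun I _ => ?_
  rw [Finset.sum_add_distrib, ← Finset.sum_mul, hpio I, ← Finset.mul_sum]
  have := chain_aux hΩ hω hχ hψ hmaps' hinv hinv' hx (hud I) I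
  simp only [hF x, Matrix.of_apply]
  rw [this]
  field_simp
  simp [u]

end

/-- fundamental identity of generalized acoustic cloaking, Lemma 3:
let `P` be a symmetric, invertible, C¹ matrix field on `ω` and `χ : Ω → ω` a C²
diffeomorphism with deformation gradient `F`, `J = det F`, `V² = F Fᵀ`.  Then
`div P = 0` holds on `ω` if and only if for every C² function `p`,
`Δ_X (p∘χ) = J P_{ij} ∂/∂x_j ( J⁻¹ (P⁻¹V²)_{ik} ∂p/∂x_k )` at `x = χ(X)`. -/
theorem fundamental_cloaking_identity {d : ℕ}
    (Ω ω : Set (Fin d → ℝ)) (hΩ : IsOpen Ω) (hω : IsOpen ω)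
    (χ ψ : (Fin d → ℝ) → (Fin d → ℝ))
    (hχ : ContDiffOn ℝ 2 χ Ω) (hψ : ContDiffOn ℝ 2 ψ ω)
    (hmaps : Set.MapsTo χ Ω ω) (hmaps' : Set.MapsTo ψ ω Ω)
    (hinv : ∀ x ∈ ω, χ (ψ x) = x) (hinv' : ∀ X ∈ Ω, ψ (χ X) = X)
    (F : (Fin d → ℝ) → Matrix (Fin d) (Fin d) ℝ)
    (hF : ∀ x, F x = Matrix.of fun i I => fderiv ℝ χ (ψ x) (Pi.single I 1) i)
    (J : (Fin d → ℝ) → ℝ) (hJ : ∀ x, J x = (F x).det)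
    (hpos : ∀ x ∈ ω, 0 < J x)
    (P : (Fin d → ℝ) → Matrix (Fin d) (Fin d) ℝ)
    (hPsymm : ∀ x ∈ ω, (P x).IsSymm)
    (hPinv : ∀ x ∈ ω, IsUnit (P x))
    (hPC1 : ∀ i j : Fin d, ContDiffOn ℝ 1 (fun y => P y i j) ω) :
    (∀ x ∈ ω, ∀ j : Fin d,
        ∑ i : Fin d, fderiv ℝ (fun y => P y i j) x (Pi.single i 1) = 0)
    ↔
    (∀ p : (Fin d → ℝ) → ℝ, ContDiff ℝ 2 p → ∀ X ∈ Ω,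
      ∑ I : Fin d,
        fderiv ℝ (fun Y => fderiv ℝ (p ∘ χ) Y (Pi.single I 1)) X (Pi.single I 1)
      = J (χ X) *
        ∑ i : Fin d, ∑ j : Fin d, P (χ X) i j *
          fderiv ℝ (fun y =>
              (J y)⁻¹ * ∑ k : Fin d, ((P y)⁻¹ * (F y * (F y)ᵀ)) i k *
                fderiv ℝ p y (Pi.single k 1))
            (χ X) (Pi.single j 1)) := by
  have hPd : ∀ x ∈ ω, ∀ i j, DifferentiableAt ℝ (fun y => P y i j) x := fun x hx i j =>
    ((hPC1 i j).contDiffAt (hω.mem_nhds hx)).differentiableAt (by norm_num)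
  -- the central formula
  have key : ∀ p : (Fin d → ℝ) → ℝ, ContDiff ℝ 2 p → ∀ x ∈ ω,
      ∑ I : Fin d, fderiv ℝ (fun Y => fderiv ℝ (p ∘ χ) Y (Pi.single I 1)) (ψ x) (Pi.single I 1)
      = J x * ∑ i : Fin d, (∑ j : Fin d, fderiv ℝ (fun y => P y j i) x (Pi.single j 1)) *
          ((J x)⁻¹ * ∑ k : Fin d, ((P x)⁻¹ * (F x * (F x)ᵀ)) i k *
                fderiv ℝ p x (Pi.single k 1)) +
        J x * ∑ i : Fin d, ∑ j : Fin d, P x i j *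
          fderiv ℝ (fun y =>
              (J y)⁻¹ * ∑ k : Fin d, ((P y)⁻¹ * (F y * (F y)ᵀ)) i k *
                fderiv ℝ p y (Pi.single k 1)) x (Pi.single j 1) := by
    intro p hp x hx
    obtain ⟨hFd, hJd, -⟩ := piola_aux hΩ hω hχ hψ hmaps' hinv hinv' hF hJ hx (hpos x hx)
    rw [← laplace_aux hΩ hω hχ hψ hmaps' hinv hinv' hF hJ hx (hpos x hx) hp, ← mul_add]
    congr 1
    have hJ0 : J x ≠ 0 := (hpos x hx).ne'
    let w : Fin d → (Fin d → ℝ) → ℝ := fun i y =>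
      (J y)⁻¹ * ∑ k : Fin d, ((P y)⁻¹ * (F y * (F y)ᵀ)) i k * fderiv ℝ p y (Pi.single k 1)
    have hpd : ∀ v, DifferentiableAt ℝ (fun y => fderiv ℝ p y v) x := fun v =>
      (diff_fderiv_aux hp.contDiffAt).clm_apply (differentiableAt_const _)
    have hPi := differentiableAt_inv_entry_aux (hPd x hx) (hPinv x hx)
    have hwd : ∀ i, DifferentiableAt ℝ (w i) x := by
      intro i
      refine (hJd.inv hJ0).mul (DifferentiableAt.fun_sum fun k _ => DifferentiableAt.mul ?_ (hpd _))
      simp only [Matrix.mul_apply, Matrix.transpose_apply]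
      exact DifferentiableAt.fun_sum fun a _ => (hPi i a).mul
        (DifferentiableAt.fun_sum fun b _ => (hFd a b).mul (hFd k b))
    have hg : ∀ j, (fun y => (J y)⁻¹ * ∑ k, (F y * (F y)ᵀ) j k * fderiv ℝ p y (Pi.single k 1))
        =ᶠ[nhds x] fun y => ∑ i, P y j i * w i y := by
      intro j
      filter_upwards [hω.mem_nhds hx] with y hy
      have hc : P y * ((P y)⁻¹ * (F y * (F y)ᵀ)) = F y * (F y)ᵀ :=
        Matrix.mul_nonsing_inv_cancel_left _ _ ((Matrix.isUnit_iff_isUnit_det _).1 (hPinv y hy))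
      conv_lhs => rw [← hc]
      simp only [w, Matrix.mul_apply (M := P y), Finset.mul_sum, Finset.sum_mul]
      rw [Finset.sum_comm]
      exact Finset.sum_congr rfl fun I _ => Finset.sum_congr rfl fun k _ => by ring
    have hder : ∀ j, fderiv ℝ (fun y => (J y)⁻¹ * ∑ k, (F y * (F y)ᵀ) j k *
          fderiv ℝ p y (Pi.single k 1)) x (Pi.single j 1) =
        ∑ i, (fderiv ℝ (fun y => P y j i) x (Pi.single j 1) * w i x +
          P x i j * fderiv ℝ (w i) x (Pi.single j 1)) := by
      intro j
      rw [(hg j).fderiv_eq, fderiv_fun_sum (fun i _ => (hPd x hx j i).fun_mul (hwd i)),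
        _root_.sum_apply]
      refine Finset.sum_congr rfl fun i _ => ?_
      rw [fderiv_fun_mul (hPd x hx j i) (hwd i), (hPsymm x hx).apply i j]
      simp
      ring
    simp only [hder]
    rw [Finset.sum_comm]
    simp only [Finset.sum_add_distrib, ← Finset.sum_mul]
    rfl
  constructor
  · intro hdiv p hp X hX
    have h := key p hp (χ X) (hmaps hX)
    simp only [hdiv (χ X) (hmaps hX), zero_mul, Finset.sum_const_zero, mul_zero, zero_add,
      hinv' X hX] at h
    exact h
  · intro H x hx
    have hJ0 : J x ≠ 0 := (hpos x hx).ne'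
    let D : Fin d → ℝ := fun i => ∑ j : Fin d, fderiv ℝ (fun y => P y j i) x (Pi.single j 1)
    let M : Matrix (Fin d) (Fin d) ℝ := (P x)⁻¹ * (F x * (F x)ᵀ)
    have hM : IsUnit M := by
      have hFu : IsUnit (F x) := by
        rw [Matrix.isUnit_iff_isUnit_det, ← hJ]
        exact hJ0.isUnit
      exact (Matrix.isUnit_nonsing_inv_iff.2 (hPinv x hx)).mul
        (hFu.mul ((Matrix.isUnit_transpose _).2 hFu))
    have hDM : D ᵥ* M = 0 := by
      funext k
      have hp : ContDiff ℝ 2 (fun y : Fin d → ℝ => y k) := contDiff_apply ℝ ℝ k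
      have h1 := key _ hp x hx
      have h2 := H _ hp (ψ x) (hmaps' hx)
      rw [hinv x hx] at h2
      rw [h2] at h1
      have h3 := right_eq_add.1 h1 |> fun h => (mul_eq_zero.1 h).resolve_left hJ0
      have hfd : ∀ l : Fin d, fderiv ℝ (fun y : Fin d → ℝ => y k) x (Pi.single l 1)
          = if l = k then 1 else 0 := by
        intro l
        rw [(hasFDerivAt_apply k x).fderiv]
        simp [Pi.single_apply, eq_comm]
      simp only [hfd, mul_ite, mul_one, mul_zero, Finset.sum_ite_eq', Finset.mem_univ, if_true]
        at h3
      have h4 : (J x)⁻¹ * ∑ i, D i * M i k = 0 := by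
        rw [← h3, Finset.mul_sum]
        exact Finset.sum_congr rfl fun i _ => by simp only [D, M]; ring
      exact (mul_eq_zero.1 h4).resolve_left (inv_ne_zero hJ0)
    have hD : D = 0 := by
      have := congrArg (· ᵥ* M⁻¹) hDM
      simpa [Matrix.vecMul_vecMul,
        Matrix.mul_nonsing_inv _ ((Matrix.isUnit_iff_isUnit_det _).1 hM)] using this
    intro j
    exact congrFun hD j
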